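/- arXiv:2303.17030 — 2 statements merged into one kernel-verified Lean document; each statement's English description precedes it below -/
import Mathlib

section
/- For every p ∈ (0,1), there exists a unique λ ∈ (0, 1/2) such that Φ^S_p(−λ) = −2(1−p)·√(2/π). (This unique solution is denoted λ_*(p), and α_*(p) := 1 − λ_*(p) ∈ (1/2, 1).) -/
open MeasureTheory Real

/-- The density of the Lévy measure `Λ` of the subordinator in the Lamperti
representation of the tagged fragment of the Brownian excursion fragmentation:
`ρ(x) = 2·exp(x)/√(2π·(exp(x) − 1)³)`. -/
noncomputable def levyDensity (x : ℝ) : ℝ :=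
  2 * Real.exp x / Real.sqrt (2 * Real.pi * (Real.exp x - 1) ^ 3)

/-- The Laplace exponent
`Φ^S_p(q) = ∫₀^∞ (1 − exp(−q·x))·(1_{(0, log 2]}(x) + p·1_{(log 2, ∞)}(x))·ρ(x) dx`. -/
noncomputable def PhiS (p q : ℝ) : ℝ :=
  ∫ x in Set.Ioi (0:ℝ), (1 - Real.exp (-q * x)) *
    ((Set.Ioc (0:ℝ) (Real.log 2)).indicator (fun _ => (1:ℝ)) x
      + p * (Set.Ioi (Real.log 2)).indicator (fun _ => (1:ℝ)) x) * levyDensity x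

/-- The weight `1_{(0, log 2]} + p·1_{(log 2, ∞)}` in the definition of `PhiS`. -/
noncomputable def cutoffWeight (p x : ℝ) : ℝ :=
  (Set.Ioc (0:ℝ) (Real.log 2)).indicator (fun _ => (1:ℝ)) x
    + p * (Set.Ioi (Real.log 2)).indicator (fun _ => (1:ℝ)) x

lemma measurable_cutoffWeight (p : ℝ) : Measurable (cutoffWeight p) :=
  (measurable_const.indicator measurableSet_Ioc).add
    ((measurable_const.indicator measurableSet_Ioi).const_mul p)

lemma cutoffWeight_of_le {p x : ℝ} (hx : 0 < x) (h : x ≤ Real.log 2) : cutoffWeight p x = 1 := by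
  simp [cutoffWeight, hx, h]

lemma cutoffWeight_of_lt {p x : ℝ} (h : Real.log 2 < x) : cutoffWeight p x = p := by
  simp [cutoffWeight, h]

lemma cutoffWeight_mem {p x : ℝ} (hp : p ∈ Set.Ioo (0:ℝ) 1) (hx : 0 < x) :
    cutoffWeight p x ∈ Set.Ioc (0:ℝ) 1 := by
  rcases le_or_gt x (Real.log 2) with h | h
  · simp [cutoffWeight_of_le hx h]
  · rw [cutoffWeight_of_lt h]
    exact ⟨hp.1, hp.2.le⟩

lemma measurable_levyDensity : Measurable levyDensity := by
  unfold levyDensity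
  fun_prop

lemma levyDensity_pos {x : ℝ} (hx : 0 < x) : 0 < levyDensity x := by
  have : 0 < Real.exp x - 1 := by linarith [Real.add_one_lt_exp hx.ne']
  unfold levyDensity
  positivity

lemma le_levyDensity {x : ℝ} (hx : 0 < x) :
    Real.sqrt (2 / π) * Real.exp (-(1 / 2) * x) ≤ levyDensity x := by
  have h1 : 0 < Real.exp x - 1 := by linarith [Real.add_one_lt_exp hx.ne']
  have hs : Real.sqrt (2 * π * (Real.exp x - 1) ^ 3)
      ≤ Real.sqrt (2 * π) * Real.exp (3 / 2 * x) := by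
    rw [Real.sqrt_le_left (by positivity), mul_pow, Real.sq_sqrt (by positivity)]
    have : Real.exp (3 / 2 * x) ^ 2 = Real.exp x ^ 3 := by
      rw [← Real.exp_nat_mul, ← Real.exp_nat_mul]; congr 1; push_cast; ring
    rw [this]
    gcongr
    linarith
  unfold levyDensity
  rw [le_div_iff₀ (by positivity)]
  calc Real.sqrt (2 / π) * Real.exp (-(1 / 2) * x) * Real.sqrt (2 * π * (Real.exp x - 1) ^ 3)
      ≤ Real.sqrt (2 / π) * Real.exp (-(1 / 2) * x) *
          (Real.sqrt (2 * π) * Real.exp (3 / 2 * x)) := by gcongr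
    _ = (Real.sqrt (2 / π) * Real.sqrt (2 * π)) *
          (Real.exp (-(1 / 2) * x) * Real.exp (3 / 2 * x)) := by ring
    _ = 2 * Real.exp x := by
      rw [← Real.sqrt_mul (by positivity), ← Real.exp_add]
      congr 1
      · rw [show 2 / π * (2 * π) = 2 ^ 2 by field_simp]
        exact Real.sqrt_sq (by norm_num)
      · congr 1; ring

lemma levyDensity_le {x : ℝ} (hx : 0 < x) :
    levyDensity x ≤ 2 * (1 + x) ^ 2 * x ^ (-(3 / 2) : ℝ) * Real.exp (-(1 / 2) * x) := by
  have h1 : Real.exp x * x / (1 + x) ≤ Real.exp x - 1 := by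
    rw [div_le_iff₀ (by positivity)]
    nlinarith [Real.add_one_le_exp x]
  have hr : (x ^ (3 / 2 : ℝ)) ^ 2 = x ^ 3 := by
    rw [← Real.rpow_natCast, ← Real.rpow_mul hx.le, ← Real.rpow_natCast]; norm_num
  have he : Real.exp (3 / 2 * x) ^ 2 = Real.exp x ^ 3 := by
    rw [← Real.exp_nat_mul, ← Real.exp_nat_mul]; congr 1; push_cast; ring
  have hs : Real.exp (3 / 2 * x) * x ^ (3 / 2 : ℝ) / (1 + x) ^ 2
      ≤ Real.sqrt (2 * π * (Real.exp x - 1) ^ 3) := by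
    apply Real.le_sqrt_of_sq_le
    rw [div_pow, mul_pow, he, hr, ← mul_pow]
    calc (Real.exp x * x) ^ 3 / ((1 + x) ^ 2) ^ 2
        ≤ (Real.exp x * x) ^ 3 / (1 + x) ^ 3 := by
          rw [← pow_mul]
          gcongr
          · linarith
          · norm_num
      _ = (Real.exp x * x / (1 + x)) ^ 3 := by rw [div_pow]
      _ ≤ (Real.exp x - 1) ^ 3 := by gcongr
      _ ≤ 2 * π * (Real.exp x - 1) ^ 3 := by
          have : 0 ≤ (Real.exp x - 1) ^ 3 := pow_nonneg (le_trans (by positivity) h1) 3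
          nlinarith [Real.pi_gt_three]
  calc levyDensity x
      ≤ 2 * Real.exp x / (Real.exp (3 / 2 * x) * x ^ (3 / 2 : ℝ) / (1 + x) ^ 2) := by
        unfold levyDensity
        gcongr
    _ = _ := by
        have : Real.exp x = Real.exp (3 / 2 * x) * Real.exp (-(1 / 2) * x) := by
          rw [← Real.exp_add]; congr 1; ring
        rw [this, Real.rpow_neg hx.le]
        field_simp

lemma exp_sub_one_le (x : ℝ) : Real.exp x - 1 ≤ x * Real.exp x := by
  have h := Real.add_one_le_exp (-x)
  have h2 : Real.exp x * Real.exp (-x) = 1 := by rw [← Real.exp_add]; simp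
  nlinarith [Real.exp_pos x]

/-- An integrable majorant of `(exp(b·x) − 1)·ρ(x)` for `b < 1/2`. -/
noncomputable def expMajorant (b x : ℝ) : ℝ :=
  x ^ (-(1 / 2) : ℝ) * Real.exp (-(1 / 2 - b) * x)
    + 2 * (x ^ (1 / 2 : ℝ) * Real.exp (-(1 / 2 - b) * x))
    + x ^ (3 / 2 : ℝ) * Real.exp (-(1 / 2 - b) * x)

lemma integrableOn_expMajorant {b : ℝ} (hb : b < 1 / 2) :
    IntegrableOn (expMajorant b) (Set.Ioi 0) := by
  have key (s : ℝ) (hs : -1 < s) :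
      IntegrableOn (fun x : ℝ => x ^ s * Real.exp (-(1 / 2 - b) * x)) (Set.Ioi 0) := by
    simpa using integrableOn_rpow_mul_exp_neg_mul_rpow (p := 1) hs one_pos
      (show 0 < 1 / 2 - b by linarith)
  exact ((key _ (by norm_num)).add ((key _ (by norm_num)).const_mul 2)).add
    (key _ (by norm_num))

lemma exp_sub_one_mul_levyDensity_le {b x : ℝ} (hb0 : 0 ≤ b) (hb : b < 1 / 2) (hx : 0 < x) :
    (Real.exp (b * x) - 1) * levyDensity x ≤ expMajorant b x := by
  have h0 : 0 ≤ Real.exp (b * x) - 1 := by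
    linarith [Real.add_one_le_exp (b * x), mul_nonneg hb0 hx.le]
  have h2 : Real.exp (b * x) - 1 ≤ 1 / 2 * x * Real.exp (b * x) :=
    (exp_sub_one_le _).trans (by gcongr)
  calc (Real.exp (b * x) - 1) * levyDensity x
      ≤ (1 / 2 * x * Real.exp (b * x)) *
        (2 * (1 + x) ^ 2 * x ^ (-(3 / 2) : ℝ) * Real.exp (-(1 / 2) * x)) :=
        mul_le_mul h2 (levyDensity_le hx) (levyDensity_pos hx).le (by positivity)
    _ = expMajorant b x := by
        have e : Real.exp (-(1 / 2 - b) * x) = Real.exp (b * x) * Real.exp (-(1 / 2) * x) := by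
          rw [← Real.exp_add]; congr 1; ring
        have r (k : ℕ) (s : ℝ) (hs : s = -(3 / 2) + k) :
            x ^ s = x ^ (-(3 / 2) : ℝ) * x ^ k := by
          rw [hs, Real.rpow_add hx, Real.rpow_natCast]
        rw [expMajorant, e, r 1 (-(1 / 2)) (by norm_num), r 2 (1 / 2) (by norm_num),
          r 3 (3 / 2) (by norm_num)]
        ring

/-- The integrand of `PhiS p (-lam)`, with the opposite sign. -/
noncomputable def negIntegrand (p lam x : ℝ) : ℝ :=
  (Real.exp (lam * x) - 1) * cutoffWeight p x * levyDensity x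

lemma PhiS_neg (p lam : ℝ) : PhiS p (-lam) = -∫ x in Set.Ioi (0:ℝ), negIntegrand p lam x := by
  rw [← integral_neg]
  unfold PhiS negIntegrand cutoffWeight
  congr 1
  ext x
  rw [neg_neg]
  ring

lemma measurable_negIntegrand (p lam : ℝ) : Measurable (negIntegrand p lam) :=
  (Measurable.mul (by fun_prop) (measurable_cutoffWeight p)).mul measurable_levyDensity

lemma negIntegrand_nonneg {p lam x : ℝ} (hp : p ∈ Set.Ioo (0:ℝ) 1) (hl : 0 ≤ lam) (hx : 0 < x) :
    0 ≤ negIntegrand p lam x := by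
  have h0 : 0 ≤ Real.exp (lam * x) - 1 := by
    linarith [Real.add_one_le_exp (lam * x), mul_nonneg hl hx.le]
  exact mul_nonneg (mul_nonneg h0 (cutoffWeight_mem hp hx).1.le) (levyDensity_pos hx).le

lemma norm_negIntegrand_le {p lam b x : ℝ} (hp : p ∈ Set.Ioo (0:ℝ) 1) (hl : 0 ≤ lam)
    (hlb : lam ≤ b) (hb : b < 1 / 2) (hx : 0 < x) :
    ‖negIntegrand p lam x‖ ≤ expMajorant b x := by
  rw [Real.norm_of_nonneg (negIntegrand_nonneg hp hl hx)]
  refine le_trans ?_ (exp_sub_one_mul_levyDensity_le (hl.trans hlb) hb hx)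
  have h0 : 0 ≤ Real.exp (lam * x) - 1 := by
    linarith [Real.add_one_le_exp (lam * x), mul_nonneg hl hx.le]
  unfold negIntegrand
  refine mul_le_mul_of_nonneg_right ?_ (levyDensity_pos hx).le
  calc (Real.exp (lam * x) - 1) * cutoffWeight p x
      ≤ Real.exp (lam * x) - 1 := mul_le_of_le_one_right h0 (cutoffWeight_mem hp hx).2
    _ ≤ Real.exp (b * x) - 1 := by gcongr

lemma integrableOn_negIntegrand {p lam : ℝ} (hp : p ∈ Set.Ioo (0:ℝ) 1) (hl : 0 ≤ lam)
    (hl' : lam < 1 / 2) : IntegrableOn (negIntegrand p lam) (Set.Ioi 0) :=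
  (integrableOn_expMajorant hl').mono' (measurable_negIntegrand p lam).aestronglyMeasurable
    ((ae_restrict_mem measurableSet_Ioi).mono fun _ hx =>
      norm_negIntegrand_le hp hl le_rfl hl' hx)

lemma continuousOn_integral_negIntegrand {p b : ℝ} (hp : p ∈ Set.Ioo (0:ℝ) 1) (hb : b < 1 / 2) :
    ContinuousOn (fun lam => ∫ x in Set.Ioi (0:ℝ), negIntegrand p lam x) (Set.Icc 0 b) := by
  refine continuousOn_of_dominated (bound := expMajorant b)
    (fun lam _ => (measurable_negIntegrand p lam).aestronglyMeasurable) ?_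
    (integrableOn_expMajorant hb) (ae_of_all _ fun x => ?_)
  · exact fun lam hl => (ae_restrict_mem measurableSet_Ioi).mono fun _ hx =>
      norm_negIntegrand_le hp hl.1 hl.2 hb hx
  · unfold negIntegrand
    fun_prop

lemma strictMonoOn_integral_negIntegrand {p : ℝ} (hp : p ∈ Set.Ioo (0:ℝ) 1) :
    StrictMonoOn (fun lam => ∫ x in Set.Ioi (0:ℝ), negIntegrand p lam x) (Set.Ico 0 (1 / 2)) := by
  intro l hl m hm hlm
  have il := integrableOn_negIntegrand hp hl.1 hl.2
  have im := integrableOn_negIntegrand hp hm.1 hm.2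
  have hpos : ∀ x ∈ Set.Ioi (0:ℝ), 0 < negIntegrand p m x - negIntegrand p l x := by
    intro x hx
    have hx : 0 < x := hx
    unfold negIntegrand
    rw [← sub_mul, ← sub_mul]
    refine mul_pos (mul_pos ?_ (cutoffWeight_mem hp hx).1) (levyDensity_pos hx)
    have : Real.exp (l * x) < Real.exp (m * x) := by gcongr
    linarith
  have h : 0 < ∫ x in Set.Ioi (0:ℝ), (negIntegrand p m x - negIntegrand p l x) := by
    rw [setIntegral_pos_iff_support_of_nonneg_ae
      ((ae_restrict_mem measurableSet_Ioi).mono fun x hx => (hpos x hx).le) (im.sub il)]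
    rw [Set.inter_eq_right.mpr fun x hx => Function.mem_support.mpr (hpos x hx).ne']
    simp
  rw [integral_sub im il] at h
  exact sub_pos.mp h

lemma le_integral_negIntegrand {p lam : ℝ} (hp : p ∈ Set.Ioo (0:ℝ) 1) (hl : 0 ≤ lam)
    (hl' : lam < 1 / 2) :
    p * Real.sqrt (2 / π) * (1 / (2 * (1 / 2 - lam)) - 2)
      ≤ ∫ x in Set.Ioi (0:ℝ), negIntegrand p lam x := by
  have i1 := integrableOn_exp_mul_Ioi (show lam - 1 / 2 < 0 by linarith) (Real.log 2)
  have i2 := integrableOn_exp_mul_Ioi (show -(1 / 2 : ℝ) < 0 by norm_num) (Real.log 2)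
  have hlog : 0 < Real.log 2 := Real.log_pos (by norm_num)
  have hsub : Set.Ioi (Real.log 2) ⊆ Set.Ioi 0 := Set.Ioi_subset_Ioi hlog.le
  have int := integrableOn_negIntegrand hp hl hl'
  have hhalf : 1 / 2 ≤ Real.exp ((lam - 1 / 2) * Real.log 2) := by
    calc (1 / 2 : ℝ) = Real.exp (-Real.log 2) := by
          rw [Real.exp_neg, Real.exp_log (by norm_num)]; norm_num
      _ ≤ _ := by gcongr; nlinarith
  have hone : Real.exp (-(1 / 2) * Real.log 2) ≤ 1 := by
    rw [Real.exp_le_one_iff]; linarith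
  calc p * Real.sqrt (2 / π) * (1 / (2 * (1 / 2 - lam)) - 2)
      ≤ p * Real.sqrt (2 / π) * ((∫ x in Set.Ioi (Real.log 2), Real.exp ((lam - 1 / 2) * x))
          - ∫ x in Set.Ioi (Real.log 2), Real.exp (-(1 / 2) * x)) := by
        rw [integral_exp_mul_Ioi (by linarith), integral_exp_mul_Ioi (by norm_num)]
        have hd : 0 < 1 / 2 - lam := by linarith
        have h1 : 1 / (2 * (1 / 2 - lam))
            ≤ -Real.exp ((lam - 1 / 2) * Real.log 2) / (lam - 1 / 2) := by
          rw [← neg_sub (1 / 2) lam, neg_div_neg_eq, neg_sub, ← div_div]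
          gcongr
        have h2 : -Real.exp (-(1 / 2) * Real.log 2) / -(1 / 2) ≤ 2 := by
          rw [neg_div_neg_eq]
          linarith
        have hp0 := hp.1
        gcongr
    _ = ∫ x in Set.Ioi (Real.log 2), p * Real.sqrt (2 / π) *
          (Real.exp ((lam - 1 / 2) * x) - Real.exp (-(1 / 2) * x)) := by
        rw [integral_const_mul, integral_sub i1 i2]
    _ ≤ ∫ x in Set.Ioi (Real.log 2), negIntegrand p lam x := by
        refine setIntegral_mono_on ((i1.sub i2).const_mul _) (int.mono_set hsub)
          measurableSet_Ioi fun x hx => ?_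
        have hx0 : 0 < x := hsub hx
        have h0 : 0 ≤ Real.exp (lam * x) - 1 := by
          linarith [Real.add_one_le_exp (lam * x), mul_nonneg hl hx0.le]
        have e : Real.exp ((lam - 1 / 2) * x) = Real.exp (lam * x) * Real.exp (-(1 / 2) * x) := by
          rw [← Real.exp_add]; congr 1; ring
        rw [negIntegrand, cutoffWeight_of_lt hx, e]
        calc _ = (Real.exp (lam * x) - 1) * p *
              (Real.sqrt (2 / π) * Real.exp (-(1 / 2) * x)) := by ring
          _ ≤ _ := mul_le_mul_of_nonneg_left (le_levyDensity hx0) (mul_nonneg h0 hp.1.le)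
    _ ≤ _ := setIntegral_mono_set int ((ae_restrict_mem measurableSet_Ioi).mono fun _ hx =>
        negIntegrand_nonneg hp hl hx) hsub.eventuallyLE

theorem stmt_8 (p : ℝ) (hp : p ∈ Set.Ioo (0:ℝ) 1) :
    ∃! lam : ℝ, lam ∈ Set.Ioo (0:ℝ) (1/2) ∧
      PhiS p (-lam) = -(2 * (1 - p) * Real.sqrt (2 / Real.pi)) := by
  simp only [PhiS_neg, neg_inj]
  obtain ⟨hp0, hp1⟩ := id hp
  have hc : 0 < 2 * (1 - p) * Real.sqrt (2 / π) := by
    have : 0 < 1 - p := by linarith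
    positivity
  have hzero : ∫ x in Set.Ioi (0:ℝ), negIntegrand p 0 x = 0 := by simp [negIntegrand]
  have hb0 : 0 ≤ 1 / 2 - p / 4 := by linarith
  have hb : 1 / 2 - p / 4 < 1 / 2 := by linarith
  have hlarge : 2 * (1 - p) * Real.sqrt (2 / π)
      ≤ ∫ x in Set.Ioi (0:ℝ), negIntegrand p (1 / 2 - p / 4) x := by
    refine le_trans (le_of_eq ?_) (le_integral_negIntegrand hp hb0 hb)
    field_simp
    ring
  obtain ⟨l, hl, hle⟩ := intermediate_value_Icc hb0 (continuousOn_integral_negIntegrand hp hb)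
    ⟨hzero.le.trans hc.le, hlarge⟩
  have hl0 : l ≠ 0 := by
    rintro rfl
    exact hc.ne (hzero.symm.trans hle)
  refine ⟨l, ⟨⟨lt_of_le_of_ne hl.1 hl0.symm, hl.2.trans_lt hb⟩, hle⟩, fun m ⟨hm, hme⟩ => ?_⟩
  exact (strictMonoOn_integral_negIntegrand hp).injOn ⟨hm.1.le, hm.2⟩
    ⟨hl.1, hl.2.trans_lt hb⟩ (hme.trans hle.symm)
end

section
/- For every p ∈ (0,1), λ^*(p) ≤ λ_*(p); equivalently, with α_*(p) := 1 − λ_*(p) and β^*(p) := 1 − λ^*(p), one has 1/2 < α_*(p) ≤ β^*(p) < 1. -/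
open MeasureTheory Real

/-- The Laplace exponent `Φ(q) = ∫₀^∞ (1 − exp(−q·x))·ρ(x) dx`. -/
noncomputable def Phi (q : ℝ) : ℝ :=
  ∫ x in Set.Ioi (0:ℝ), (1 - Real.exp (-q * x)) * levyDensity x

lemma levyDensity_nonneg (x : ℝ) : 0 ≤ levyDensity x := by
  unfold levyDensity
  positivity

lemma mul_exp_sub_one_le {a b x : ℝ} (ha : 0 < a) (hab : a ≤ b) :
    b / a * (Real.exp (a * x) - 1) ≤ Real.exp (b * x) - 1 := by
  have h := one_add_mul_self_le_rpow_one_add (s := Real.exp (a * x) - 1)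
    (by linarith [Real.exp_pos (a * x)]) (p := b / a) ((one_le_div ha).2 hab)
  have h' : Real.exp (a * x) ^ (b / a) = Real.exp (b * x) := by
    rw [← Real.exp_mul]
    congr 1
    field_simp
  rw [add_sub_cancel, h'] at h
  linarith

/-- Superlinearity of `q ↦ -Φ(-q)`, compared with the thinned exponent `Φ^S_p`. -/
lemma mul_neg_PhiS_le_neg_Phi {p a b : ℝ} (hp : p ∈ Set.Ioo (0 : ℝ) 1) (ha : 0 < a)
    (hab : a ≤ b) (hS : PhiS p (-a) ≠ 0) (hPhi : Phi (-b) ≠ 0) :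
    b / a * -PhiS p (-a) ≤ -Phi (-b) := by
  have iS := not_imp_comm.1 integral_undef hS
  have iPhi := not_imp_comm.1 integral_undef hPhi
  have key : Phi (-b) ≤ b / a * PhiS p (-a) := by
    unfold Phi PhiS
    rw [← integral_const_mul]
    refine setIntegral_mono_on iPhi (iS.const_mul _) measurableSet_Ioi fun x hx => ?_
    have hx0 : (0 : ℝ) < x := hx
    set w := (Set.Ioc (0 : ℝ) (Real.log 2)).indicator (fun _ => (1 : ℝ)) x
      + p * (Set.Ioi (Real.log 2)).indicator (fun _ => (1 : ℝ)) x with hw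
    have hw1 : w ≤ 1 := by
      by_cases h : x ≤ Real.log 2
      · simp [hw, hx0, h]
      · simpa [hw, h, not_le.1 h] using hp.2.le
    have h1 := mul_exp_sub_one_le (x := x) ha hab
    have h2 : 0 ≤ b / a * (Real.exp (a * x) - 1) :=
      mul_nonneg (div_nonneg (ha.le.trans hab) ha.le)
        (sub_nonneg.2 (Real.one_le_exp (by positivity)))
    have h3 : b / a * (Real.exp (a * x) - 1) * w ≤ Real.exp (b * x) - 1 :=
      (mul_le_of_le_one_right h2 hw1).trans h1
    have h4 := mul_le_mul_of_nonneg_right h3 (levyDensity_nonneg x)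
    simp only [neg_neg]
    linarith
  linarith

lemma exp_neg_mem_Ioo {β : ℝ} (hβ : β ∈ Set.Ioo (0 : ℝ) (Real.log 2)) :
    Real.exp (-β) ∈ Set.Ioo (1 / 2 : ℝ) 1 := by
  refine ⟨?_, by simpa using hβ.1⟩
  rw [one_div, ← Real.exp_log (show (0 : ℝ) < 2 by norm_num), ← Real.exp_neg]
  exact Real.exp_lt_exp.2 (neg_lt_neg hβ.2)

lemma one_sub_exp_mul_le {β γ : ℝ} (hβ : β ∈ Set.Ioo (0 : ℝ) (Real.log 2)) (hγ : γ < 0) :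
    (1 - Real.exp γ) * ((2 * Real.exp (-β) - 1) /
      Real.sqrt (Real.exp (-β) * (1 - Real.exp (-β)))) ≤ 1 - γ / β := by
  obtain ⟨hr2, hr1⟩ := exp_neg_mem_Ioo hβ
  have h0 := hβ.1
  have hβr : β * Real.exp (-β) ≤ 1 - Real.exp (-β) := by
    have h := mul_le_mul_of_nonneg_right (Real.add_one_le_exp β) (Real.exp_pos (-β)).le
    rw [← Real.exp_add, add_neg_cancel, Real.exp_zero] at h
    linarith
  set r := Real.exp (-β)
  have he : 0 < 1 - Real.exp γ := by simpa using hγ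
  have he1 : 1 - Real.exp γ ≤ -γ := by linarith [Real.add_one_le_exp γ]
  have he2 : 1 - Real.exp γ ≤ 1 := by linarith [Real.exp_pos γ]
  have ht : 0 < Real.sqrt (r * (1 - r)) := Real.sqrt_pos.2 (by nlinarith)
  have hrt : 1 - r ≤ Real.sqrt (r * (1 - r)) := Real.le_sqrt_of_sq_le (by nlinarith)
  have hratio : (2 * r - 1) / Real.sqrt (r * (1 - r)) ≤ 1 + r / (1 - r) := by
    have h1r : 0 < 1 - r := by linarith
    rw [show 1 + r / (1 - r) = 1 / (1 - r) by field_simp; ring, div_le_div_iff₀ ht h1r]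
    nlinarith
  have hrβ : r / (1 - r) ≤ 1 / β := by
    rw [div_le_div_iff₀ (by linarith) h0]
    linarith
  have h5 : (1 - Real.exp γ) * (1 / β) ≤ -γ * (1 / β) :=
    mul_le_mul_of_nonneg_right he1 (by positivity)
  calc _ ≤ (1 - Real.exp γ) * (1 + 1 / β) :=
        mul_le_mul_of_nonneg_left (by linarith) he.le
    _ ≤ 1 + -γ * (1 / β) := by linarith
    _ = 1 - γ / β := by ring

theorem stmt_17 (p : ℝ) (hp : p ∈ Set.Ioo (0:ℝ) 1)
    (lamLower : ℝ)
    (hlam : lamLower ∈ Set.Ioo (0:ℝ) (1/2) ∧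
      PhiS p (-lamLower) = -(2 * (1 - p) * Real.sqrt (2 / Real.pi)))
    (kappa : ℝ → ℝ → ℝ)
    (hk : ∀ γ < (0:ℝ), ∀ r ∈ Set.Ioo (1/2 : ℝ) 1, kappa γ r ∈ Set.Ioo (0:ℝ) (1/2) ∧
      Phi (-(kappa γ r)) = -(2 * (1 - p) * (1 - Real.exp γ) * Real.sqrt (2 / Real.pi) *
        (2 * r - 1) / Real.sqrt (r * (1 - r))))
    (lamUpper : ℝ)
    (hlamUpper : lamUpper = sSup { x : ℝ | ∃ β ∈ Set.Ioo (0:ℝ) (Real.log 2), ∃ δ > (0:ℝ),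
      x = min (β * δ)
        (sSup { y : ℝ | ∃ γ < (0:ℝ), y = γ * δ + kappa γ (Real.exp (-β)) }) }) :
    lamUpper ≤ lamLower ∧
    (1/2 : ℝ) < 1 - lamLower ∧ 1 - lamLower ≤ 1 - lamUpper ∧ 1 - lamUpper < 1 := by
  obtain ⟨⟨hl0, hl2⟩, hl⟩ := hlam
  have hD : 0 < 2 * (1 - p) * Real.sqrt (2 / Real.pi) := by
    have : 0 < 1 - p := by linarith [hp.2]
    positivity
  have hkappa : ∀ β ∈ Set.Ioo (0 : ℝ) (Real.log 2), ∀ γ < (0 : ℝ),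
      kappa γ (Real.exp (-β)) ≤ lamLower * (1 - γ / β) := by
    intro β hβ γ hγ
    have hk2 := (hk γ hγ _ (exp_neg_mem_Ioo hβ)).2
    have hineq := one_sub_exp_mul_le hβ hγ
    obtain ⟨hr1, hr2⟩ := exp_neg_mem_Ioo hβ
    set r := Real.exp (-β)
    by_contra! hlt
    have hge : lamLower ≤ kappa γ r := by
      have : γ / β < 0 := div_neg_of_neg_of_pos hγ hβ.1
      nlinarith
    have he : 0 < 1 - Real.exp γ := by simpa using hγ
    have hR : 0 < (2 * r - 1) / Real.sqrt (r * (1 - r)) :=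
      div_pos (by linarith) (Real.sqrt_pos.2 (by nlinarith))
    have hk3 : Phi (-(kappa γ r)) = -(2 * (1 - p) * Real.sqrt (2 / Real.pi) *
        ((1 - Real.exp γ) * ((2 * r - 1) / Real.sqrt (r * (1 - r))))) := by
      rw [hk2]
      ring
    have hmain := mul_neg_PhiS_le_neg_Phi hp hl0 hge (by rw [hl]; exact (neg_neg_of_pos hD).ne)
      (by rw [hk3]; exact (neg_neg_of_pos (mul_pos hD (mul_pos he hR))).ne)
    rw [hk3, hl, neg_neg, neg_neg, mul_comm, mul_le_mul_iff_right₀ hD,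
      div_le_iff₀ hl0] at hmain
    nlinarith
  have hbound : ∀ β ∈ Set.Ioo (0 : ℝ) (Real.log 2), ∀ δ > (0 : ℝ),
      min (β * δ) (sSup {y : ℝ | ∃ γ < (0 : ℝ), y = γ * δ + kappa γ (Real.exp (-β))})
        ≤ lamLower := by
    intro β hβ δ hδ
    rcases le_or_gt (β * δ) lamLower with h | h
    · exact (min_le_left _ _).trans h
    · refine (min_le_right _ _).trans (Real.sSup_le ?_ hl0.le)
      rintro y ⟨γ, hγ, rfl⟩
      have h1 := hkappa β hβ γ hγ
      have h2 : lamLower / β ≤ δ := (div_le_iff₀ hβ.1).2 (by linarith)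
      have h3 : γ * δ ≤ γ * (lamLower / β) := mul_le_mul_of_nonpos_left h2 hγ.le
      have h4 : lamLower * (1 - γ / β) = lamLower - γ * (lamLower / β) := by ring
      linarith
  have hle : lamUpper ≤ lamLower := by
    rw [hlamUpper]
    refine Real.sSup_le ?_ hl0.le
    rintro x ⟨β, hβ, δ, hδ, rfl⟩
    exact hbound β hβ δ hδ
  have hpos : 0 < lamUpper := by
    have hlog : 0 < Real.log 2 := Real.log_pos (by norm_num)
    obtain ⟨β, hβ⟩ : (Set.Ioo (0 : ℝ) (Real.log 2)).Nonempty := Set.nonempty_Ioo.2 hlog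
    obtain ⟨hk0, -⟩ := (hk (-1) (by norm_num) _ (exp_neg_mem_Ioo hβ)).1
    have hδ : 0 < kappa (-1) (Real.exp (-β)) / 2 := by linarith
    rw [hlamUpper]
    refine lt_of_lt_of_le (lt_min (mul_pos hβ.1 hδ) (lt_of_lt_of_le hδ ?_))
      (le_csSup ⟨lamLower, ?_⟩ ⟨β, hβ, kappa (-1) (Real.exp (-β)) / 2, hδ, rfl⟩)
    · refine le_csSup ⟨1 / 2, ?_⟩ ⟨-1, by norm_num, by ring⟩
      rintro y ⟨γ, hγ, rfl⟩
      have := (hk γ hγ _ (exp_neg_mem_Ioo hβ)).1.2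
      nlinarith
    · rintro x ⟨β, hβ, δ, hδ, rfl⟩
      exact hbound β hβ δ hδ
  exact ⟨hle, by linarith, by linarith, by linarith⟩
end
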